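/- The fourth derivative of h is strictly positive on (0, ∞) and is given there by h^{(4)}(s) = [e^{5s} + 5(6s − 25)e^{4s} + 10(33s − 35)e^{3s} + 10(33s + 35)e^{2s} + 5(6s + 25)e^{s} − 1] / [30 (e^{s} − 1)^5]. -/

import Mathlib

open Real Set

/-- `h(s) = s/(1 − e^{−s}) − 1 − s/2 − s²/12 + s⁴/720`. -/
noncomputable def hfun (s : ℝ) : ℝ :=
  s / (1 - Real.exp (-s)) - 1 - s / 2 - s ^ 2 / 12 + s ^ 4 / 720

lemma hfun_eq_inv_exp_sub_one {s : ℝ} (hs : 0 < s) :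
    hfun s = s + s * (exp s - 1)⁻¹ - 1 - s / 2 - s ^ 2 / 12 + s ^ 4 / 720 := by
  have h : exp s - 1 ≠ 0 := by linarith [one_lt_exp_iff.2 hs]
  have h' : 1 - (exp s)⁻¹ ≠ 0 := by
    have := inv_lt_one_of_one_lt₀ (one_lt_exp_iff.2 hs)
    linarith
  have key : s / (1 - (exp s)⁻¹) = s + s * (exp s - 1)⁻¹ := by
    rw [div_eq_iff h']
    field_simp
    ring
  rw [hfun, exp_neg, key]

lemma hasDerivAt_inv_exp_sub_one {s : ℝ} (hs : 0 < s) :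
    HasDerivAt (fun x : ℝ => (exp x - 1)⁻¹)
      (-((exp s - 1)⁻¹ + (exp s - 1)⁻¹ ^ 2)) s := by
  have h : exp s - 1 ≠ 0 := by linarith [one_lt_exp_iff.2 hs]
  refine (((hasDerivAt_exp s).sub_const 1).inv h).congr_deriv ?_
  field_simp
  ring

lemma iteratedDeriv_succ_eqOn_Ioi {f g g' : ℝ → ℝ} {a : ℝ} {n : ℕ}
    (hf : EqOn (iteratedDeriv n f) g (Ioi a)) (hg : ∀ x ∈ Ioi a, HasDerivAt g (g' x) x) :
    EqOn (iteratedDeriv (n + 1) f) g' (Ioi a) := by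
  intro x hx
  rw [iteratedDeriv_succ, (hf.eventuallyEq_of_mem (Ioi_mem_nhds hx)).deriv_eq]
  exact (hg x hx).deriv

lemma iteratedDeriv_four_hfun {s : ℝ} (hs : 0 < s) :
    iteratedDeriv 4 hfun s =
      -4 * ((exp s - 1)⁻¹ + 7 * (exp s - 1)⁻¹ ^ 2 + 12 * (exp s - 1)⁻¹ ^ 3
          + 6 * (exp s - 1)⁻¹ ^ 4)
        + s * ((1 + 14 * (exp s - 1)⁻¹ + 36 * (exp s - 1)⁻¹ ^ 2 + 24 * (exp s - 1)⁻¹ ^ 3)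
          * ((exp s - 1)⁻¹ + (exp s - 1)⁻¹ ^ 2)) + 1 / 30 := by
  set y : ℝ → ℝ := fun x => (exp x - 1)⁻¹
  have hd : ∀ x ∈ Ioi (0 : ℝ), HasDerivAt y (-(y x + y x ^ 2)) x :=
    fun x hx => hasDerivAt_inv_exp_sub_one hx
  have h0 : EqOn (iteratedDeriv 0 hfun)
      (fun x => x + x * y x - 1 - x / 2 - x ^ 2 / 12 + x ^ 4 / 720) (Ioi 0) := by
    intro x hx
    rw [iteratedDeriv_zero]
    exact hfun_eq_inv_exp_sub_one hx
  have h1 := iteratedDeriv_succ_eqOn_Ioi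
    (g' := fun x => 1 / 2 + y x - x * (y x + y x ^ 2) - x / 6 + x ^ 3 / 180) h0 (by
      intro x hx
      have hi := hasDerivAt_id' x
      refine HasDerivAt.congr_deriv
        (((((hi.add (hi.mul (hd x hx))).sub_const 1).sub (hi.div_const 2)).sub
        ((hi.pow 2).div_const 12)).add ((hi.pow 4).div_const 720)) ?_
      push_cast
      ring)
  have h2 := iteratedDeriv_succ_eqOn_Ioi
    (g' := fun x => -2 * (y x + y x ^ 2) + x * (y x + 3 * y x ^ 2 + 2 * y x ^ 3)
      - 1 / 6 + x ^ 2 / 60) h1 (by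
      intro x hx
      have hi := hasDerivAt_id' x
      have h := hd x hx
      refine HasDerivAt.congr_deriv ((((h.const_add (1 / 2)).sub (hi.mul (h.add (h.pow 2)))).sub
        (hi.div_const 6)).add ((hi.pow 3).div_const 180)) ?_
      simp only [Pi.add_apply, Pi.pow_apply]
      push_cast
      ring)
  have h3 := iteratedDeriv_succ_eqOn_Ioi
    (g' := fun x => 3 * (y x + 3 * y x ^ 2 + 2 * y x ^ 3)
      - x * (y x + 7 * y x ^ 2 + 12 * y x ^ 3 + 6 * y x ^ 4) + x / 30) h2 (by
      intro x hx
      have hi := hasDerivAt_id' x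
      have h := hd x hx
      refine HasDerivAt.congr_deriv (((((h.add (h.pow 2)).const_mul (-2)).add (hi.mul ((h.add
        ((h.pow 2).const_mul 3)).add ((h.pow 3).const_mul 2)))).sub_const (1 / 6)).add
        ((hi.pow 2).div_const 60)) ?_
      simp only [Pi.add_apply, Pi.pow_apply]
      push_cast
      ring)
  have h4 := iteratedDeriv_succ_eqOn_Ioi
    (g' := fun x => -4 * (y x + 7 * y x ^ 2 + 12 * y x ^ 3 + 6 * y x ^ 4)
      + x * ((1 + 14 * y x + 36 * y x ^ 2 + 24 * y x ^ 3) * (y x + y x ^ 2)) + 1 / 30) h3 (by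
      intro x hx
      have hi := hasDerivAt_id' x
      have h := hd x hx
      refine HasDerivAt.congr_deriv
        (((((h.add ((h.pow 2).const_mul 3)).add ((h.pow 3).const_mul 2)).const_mul 3).sub
        (hi.mul (((h.add ((h.pow 2).const_mul 7)).add ((h.pow 3).const_mul 12)).add
        ((h.pow 4).const_mul 6)))).add (hi.div_const 30)) ?_
      simp only [Pi.add_apply, Pi.pow_apply]
      push_cast
      ring)
  exact h4 hs

lemma hasSum_exp_mul (k s : ℝ) :
    HasSum (fun n : ℕ => k ^ n * (s ^ n / n.factorial)) (exp (k * s)) := by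
  have h := NormedSpace.expSeries_div_hasSum_exp (k * s)
  rw [← exp_eq_exp_ℝ] at h
  refine h.congr_fun fun n => ?_
  rw [mul_pow, mul_div_assoc]

lemma hasSum_mul_exp_mul {k : ℝ} (hk : k ≠ 0) (s : ℝ) :
    HasSum (fun n : ℕ => n * k ^ n / k * (s ^ n / n.factorial)) (s * exp (k * s)) := by
  rw [← hasSum_nat_add_iff' 1]
  simp only [Finset.range_one, Finset.sum_singleton, Nat.cast_zero, zero_mul, zero_div, sub_zero]
  refine ((hasSum_exp_mul k s).mul_left s).congr_fun fun n => ?_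
  rw [Nat.factorial_succ]
  have := n.factorial_ne_zero
  push_cast
  field_simp
  ring

/-- The `n`-th Taylor coefficient at `0`, times `n!`, of the numerator of `h⁗`
without its constant term. -/
noncomputable def numeratorCoeff (n : ℕ) : ℝ :=
  5 ^ n + (30 * (n * 4 ^ n / 4) - 125 * 4 ^ n) + (330 * (n * 3 ^ n / 3) - 350 * 3 ^ n)
    + (330 * (n * 2 ^ n / 2) + 350 * 2 ^ n) + (30 * (n * 1 ^ n / 1) + 125 * 1 ^ n)

lemma numeratorCoeff_nonneg (n : ℕ) : 0 ≤ numeratorCoeff n := by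
  unfold numeratorCoeff
  rcases lt_or_ge n 17 with h | h
  · interval_cases n <;> norm_num
  · have hn : (17 : ℝ) ≤ n := by exact_mod_cast h
    have h4 : 0 ≤ (30 * (n : ℝ) / 4 - 125) * 4 ^ n := mul_nonneg (by linarith) (by positivity)
    have h3 : 0 ≤ (330 * (n : ℝ) / 3 - 350) * 3 ^ n := mul_nonneg (by linarith) (by positivity)
    have h5 : (0 : ℝ) ≤ 5 ^ n + (330 * (n * 2 ^ n / 2) + 350 * 2 ^ n)
      + (30 * (n * 1 ^ n / 1) + 125 * 1 ^ n) := by positivity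
    linarith

lemma numerator_pos {s : ℝ} (hs : 0 < s) :
    0 < exp (5 * s) + 5 * (6 * s - 25) * exp (4 * s) + 10 * (33 * s - 35) * exp (3 * s)
      + 10 * (33 * s + 35) * exp (2 * s) + 5 * (6 * s + 25) * exp s - 1 := by
  have hsum : HasSum (fun n : ℕ => numeratorCoeff n * (s ^ n / n.factorial))
      (exp (5 * s) + (30 * (s * exp (4 * s)) - 125 * exp (4 * s))
        + (330 * (s * exp (3 * s)) - 350 * exp (3 * s))
        + (330 * (s * exp (2 * s)) + 350 * exp (2 * s))
        + (30 * (s * exp (1 * s)) + 125 * exp (1 * s))) := by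
    have e := fun k : ℝ => hasSum_exp_mul k s
    have m := fun (k : ℝ) (hk : k ≠ 0) => hasSum_mul_exp_mul hk s
    refine HasSum.congr_fun
      (((((e 5).add (((m 4 (by norm_num)).mul_left 30).sub ((e 4).mul_left 125))).add
      (((m 3 (by norm_num)).mul_left 330).sub ((e 3).mul_left 350))).add
      (((m 2 (by norm_num)).mul_left 330).add ((e 2).mul_left 350))).add
      (((m 1 (by norm_num)).mul_left 30).add ((e 1).mul_left 125))) fun n => ?_
    rw [numeratorCoeff]
    ring
  have hle := sum_le_hasSum (Finset.range 8)
    (fun n _ => mul_nonneg (numeratorCoeff_nonneg n) (by positivity)) hsum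
  have hlow : (Finset.range 8).sum (fun n => numeratorCoeff n * (s ^ n / n.factorial))
      = 1 + 1800 * (s ^ 7 / 5040) := by
    simp only [Finset.sum_range_succ, Finset.sum_range_zero, numeratorCoeff, Nat.factorial]
    norm_num
  rw [hlow, one_mul] at hle
  have : 0 < s ^ 7 := by positivity
  linarith

/-- The fourth derivative of `h` is strictly positive on `(0, ∞)` and equals
`[e^{5s} + 5(6s−25)e^{4s} + 10(33s−35)e^{3s} + 10(33s+35)e^{2s} + 5(6s+25)eˢ − 1] / [30(eˢ−1)⁵]`
there. -/
theorem hfun_fourth_deriv (s : ℝ) (hs : 0 < s) :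
    0 < iteratedDeriv 4 hfun s ∧
      iteratedDeriv 4 hfun s =
        (Real.exp (5 * s) + 5 * (6 * s - 25) * Real.exp (4 * s)
            + 10 * (33 * s - 35) * Real.exp (3 * s) + 10 * (33 * s + 35) * Real.exp (2 * s)
            + 5 * (6 * s + 25) * Real.exp s - 1) / (30 * (Real.exp s - 1) ^ 5) := by
  have hpos : 0 < exp s - 1 := by linarith [one_lt_exp_iff.2 hs]
  have heq : iteratedDeriv 4 hfun s =
        (Real.exp (5 * s) + 5 * (6 * s - 25) * Real.exp (4 * s)
            + 10 * (33 * s - 35) * Real.exp (3 * s) + 10 * (33 * s + 35) * Real.exp (2 * s)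
            + 5 * (6 * s + 25) * Real.exp s - 1) / (30 * (Real.exp s - 1) ^ 5) := by
    have hexp (n : ℕ) : exp (n * s) = exp s ^ n := exp_nat_mul s n
    have e5 := hexp 5
    have e4 := hexp 4
    have e3 := hexp 3
    have e2 := hexp 2
    push_cast at e5 e4 e3 e2
    have hne := hpos.ne'
    rw [iteratedDeriv_four_hfun hs, e5, e4, e3, e2]
    field_simp
    ring
  refine ⟨?_, heq⟩
  rw [heq]
  exact div_pos (numerator_pos hs) (by positivity)
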